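/- arXiv:1801.07627 — 2 statements merged into one kernel-verified Lean document; each statement's English description precedes it below -/
import Mathlib

section
/- Let G be a finite abelian group, M a subgroup of G, H = G/M the quotient group, and f : G → ℂ. Then the periodic autocorrelation function of the M-compression f^M of f equals the M-compression of the periodic autocorrelation function of f: for all x ∈ G, paf_{f^M}(xM) = ∑_{z∈M} paf_f(xz). -/
open Finset

/-- The periodic autocorrelation function `paf_f(x) = ∑_{y∈G} f(xy)·conj(f(y))`
(on any finite multiplicative structure). -/
noncomputable def paf {G : Type*} [Mul G] [Fintype G] (f : G → ℂ) (x : G) : ℂ :=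
  ∑ y : G, f (x * y) * (starRingEnd ℂ) (f y)

/-- Compression commutes with periodic autocorrelation: if `f^M` is the `M`-compression
of `f : G → ℂ`, i.e. `f^M(xM) = ∑_{z∈M} f(xz)`, then
`paf_{f^M}(xM) = ∑_{z∈M} paf_f(xz)` for all `x ∈ G`. -/
theorem paf_compression {G : Type*} [CommGroup G] [Fintype G] (M : Subgroup G)
    [Fintype M] [Fintype (G ⧸ M)] (f : G → ℂ) (fM : G ⧸ M → ℂ)
    (hfM : ∀ x : G, fM (x : G ⧸ M) = ∑ z : M, f (x * z)) :
    ∀ x : G, paf fM (x : G ⧸ M) = ∑ z : M, paf f (x * z) := by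
  classical
  intro x
  have key : ∀ q : G ⧸ M, ∑ y ∈ (Finset.univ : Finset G).filter (fun y : G => (QuotientGroup.mk y : G ⧸ M) = q), f y = fM q := by
    intro q
    induction q using QuotientGroup.induction_on with
    | H a =>
      rw [hfM]
      symm
      refine Finset.sum_bij (fun (z : M) _ => a * (z : G)) ?_ ?_ ?_ ?_
      · intro z _
        simp
      · intro z _ w _ h
        exact Subtype.ext (mul_left_cancel h)
      · intro b hb
        have hb' : (a : G ⧸ M) = b := ((Finset.mem_filter.mp hb).2).symm
        exact ⟨⟨a⁻¹ * b, QuotientGroup.eq.mp hb'⟩, Finset.mem_univ _, by simp⟩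
      · intro z _
        rfl
  have rhs : ∑ z : M, paf f (x * z)
      = ∑ y : G, fM ((x : G ⧸ M) * (y : G ⧸ M)) * (starRingEnd ℂ) (f y) := by
    unfold paf
    rw [Finset.sum_comm]
    refine Finset.sum_congr rfl fun y _ => ?_
    rw [← QuotientGroup.mk_mul, hfM, Finset.sum_mul]
    refine Finset.sum_congr rfl fun z _ => ?_
    rw [mul_right_comm]
  rw [rhs, ← Finset.sum_fiberwise (s := Finset.univ) (g := fun y : G => (y : G ⧸ M))]
  unfold paf
  refine Finset.sum_congr rfl fun q _ => ?_
  rw [← key q, map_sum, Finset.mul_sum]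
  refine Finset.sum_congr rfl fun y hy => ?_
  rw [(Finset.mem_filter.mp hy).2]
end

section
/- Let G be a finite abelian group of order v, M a subgroup of order m, and H = G/M of order d = v/m. Let f₁, …, f_t : G → ℂ be complementary functions with paf-constants α₀ and α, so with psd-constants β₀ = α₀ + (v−1)α and β = α₀ − α. Then the psd-constants of the compressed complementary functions f₁^M, …, f_t^M on H are the same: β₀^M = α₀^M + (d−1)α^M = β₀ and β^M = α₀^M − α^M = β, where α₀^M = α₀ + (m−1)α and α^M = mα. -/
open Finset

/-- `f₁,…,f_t` are complementary with paf-constants `α₀, α`. -/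
def Complementary {G : Type*} [CommGroup G] [Fintype G] {t : ℕ} (f : Fin t → G → ℂ)
    (α₀ α : ℂ) : Prop :=
  (∑ i, paf (f i) (1 : G) = α₀) ∧ ∀ s : G, s ≠ 1 → ∑ i, paf (f i) s = α

theorem sum_quot_aux {G : Type*} [CommGroup G] [Fintype G] (M : Subgroup G)
    [Fintype M] [Fintype (G ⧸ M)] (F : G → ℂ) (K : G ⧸ M → ℂ)
    (hK : ∀ x : G, K (x : G ⧸ M) = ∑ z : M, F (x * z)) : ∑ q, K q = ∑ y, F y := by
  classical
  rw [← Finset.sum_fiberwise (s := (Finset.univ : Finset G)) (g := fun y : G => (y : G ⧸ M))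
    (f := F)]
  refine Finset.sum_congr rfl fun q _ => ?_
  obtain ⟨x, rfl⟩ := QuotientGroup.mk_surjective q
  rw [hK]
  refine Finset.sum_bij (fun z _ => x * (z : G)) ?_ ?_ ?_ ?_
  · intro z _
    simp
  · intro a _ b _ hab
    exact Subtype.ext (mul_left_cancel hab)
  · intro b hb
    have hb' : (b : G ⧸ M) = x := by simpa using hb
    exact ⟨⟨x⁻¹ * b, QuotientGroup.eq.1 hb'.symm⟩, by simp, by simp⟩
  · intro z _
    rfl

theorem paf_compress_aux {G : Type*} [CommGroup G] [Fintype G] (M : Subgroup G)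
    [Fintype M] [Fintype (G ⧸ M)] (f : G → ℂ) (fM : G ⧸ M → ℂ)
    (hfM : ∀ (x : G), fM (x : G ⧸ M) = ∑ z : M, f (x * z)) (x : G) :
    paf fM (x : G ⧸ M) = ∑ z : M, paf f (x * z) := by
  unfold paf
  rw [sum_quot_aux M (fun y => fM ((x * y : G) : G ⧸ M) * (starRingEnd ℂ) (f y))]
  · rw [Finset.sum_comm]
    refine Finset.sum_congr rfl fun y _ => ?_
    rw [hfM, Finset.sum_mul]
    refine Finset.sum_congr rfl fun z _ => ?_
    rw [mul_right_comm]
  · intro y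
    rw [hfM y, map_sum, Finset.mul_sum]
    refine Finset.sum_congr rfl fun z _ => ?_
    have : ((x * (y * z) : G) : G ⧸ M) = (x : G ⧸ M) * (y : G ⧸ M) := by
      rw [← QuotientGroup.mk_mul, ← mul_assoc]
      simp
    rw [this]

/-- The psd-constants are invariant under compression: if `f₁,…,f_t : G → ℂ` are
complementary with paf-constants `α₀, α` (hence psd-constants `β₀ = α₀ + (v−1)α`,
`β = α₀ − α`), then the `M`-compressions are complementary on `H = G/M` (of order
`d = v/m`) with paf-constants `α₀^M = α₀ + (m−1)α`, `α^M = mα`, and their psd-constants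
agree with those of the original family:
`β₀^M = α₀^M + (d−1)α^M = β₀` and `β^M = α₀^M − α^M = β`. -/
theorem compression_psd_constants {G : Type*} [CommGroup G] [Fintype G] (M : Subgroup G)
    [Fintype M] [Fintype (G ⧸ M)] {t : ℕ} (f : Fin t → G → ℂ) (α₀ α : ℂ)
    (h : Complementary f α₀ α) (fM : Fin t → G ⧸ M → ℂ)
    (hfM : ∀ i (x : G), fM i (x : G ⧸ M) = ∑ z : M, f i (x * z)) :
    Complementary fM (α₀ + ((Fintype.card M : ℂ) - 1) * α) ((Fintype.card M : ℂ) * α) ∧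
    (α₀ + ((Fintype.card M : ℂ) - 1) * α) +
        ((Fintype.card (G ⧸ M) : ℂ) - 1) * ((Fintype.card M : ℂ) * α) =
      α₀ + ((Fintype.card G : ℂ) - 1) * α ∧
    (α₀ + ((Fintype.card M : ℂ) - 1) * α) - (Fintype.card M : ℂ) * α = α₀ - α := by
  classical
  have key : ∀ x : G, ∑ i, paf (fM i) (x : G ⧸ M) = ∑ z : M, ∑ i, paf (f i) (x * z) := by
    intro x
    rw [Finset.sum_comm]
    exact Finset.sum_congr rfl fun i _ => paf_compress_aux M (f i) (fM i) (hfM i) x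
  obtain ⟨h1, h2⟩ := h
  refine ⟨⟨?_, ?_⟩, ?_, by ring⟩
  · have := key 1
    rw [QuotientGroup.mk_one] at this
    rw [this, ← Finset.add_sum_erase _ _ (Finset.mem_univ (1 : M))]
    rw [Finset.sum_congr (s₁ := Finset.univ.erase (1 : M)) rfl (g := fun _ => α)]
    · have hc : 1 ≤ Fintype.card M := Fintype.card_pos
      rw [Finset.sum_const, Finset.card_erase_of_mem (Finset.mem_univ _), Finset.card_univ,
        nsmul_eq_mul, Nat.cast_sub hc]
      simp [h1]
    · intro z hz
      apply h2
      simpa using hz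
  · intro s hs
    obtain ⟨x, rfl⟩ := QuotientGroup.mk_surjective s
    rw [key x, Finset.sum_congr rfl (g := fun _ => α)]
    · simp
    · intro z _
      apply h2
      intro hxz
      apply hs
      rw [QuotientGroup.eq_one_iff, eq_inv_of_mul_eq_one_left hxz]
      exact M.inv_mem z.2
  · have hc : Fintype.card G = Fintype.card (G ⧸ M) * Fintype.card M := by
      simpa [Nat.card_eq_fintype_card] using Subgroup.card_eq_card_quotient_mul_card_subgroup M
    rw [hc]
    push_cast
    ring
end
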